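/- arXiv:1111.4379 — 2 statements merged into one kernel-verified Lean document; each statement's English description precedes it below -/
import Mathlib

section
/- (LU-equivalence criterion in the nondegenerate case) Let Ω and Ω' be tensors in HOSVD form such that for every mode n the diagonal entries of G_n(Ω) are pairwise distinct. Then Ω and Ω' are LU equivalent if and only if there exist real phases θ^(n)_j (for n = 1,…,N and j = 1,…,d(n)) such that Ω'(j_1,…,j_N) = exp(i(θ^(1)_{j_1} + θ^(2)_{j_2} + ⋯ + θ^(N)_{j_N}))·Ω(j_1,…,j_N) for every multi-index. -/
open Matrix

/-- An `N`-partite tensor on local dimensions `d 1, …, d N`. -/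
def Tensor {N : ℕ} (d : Fin N → ℕ) : Type := (∀ n, Fin (d n)) → ℂ

/-- Action of a family of local matrices on a tensor:
`(U·Ψ)(j) = Σ_k (Π_n U^(n)_{j_n k_n}) Ψ(k)`. -/
noncomputable def luAct {N : ℕ} {d : Fin N → ℕ}
    (U : ∀ n, Matrix (Fin (d n)) (Fin (d n)) ℂ) (Ψ : Tensor d) : Tensor d :=
  fun j => ∑ k : ∀ n, Fin (d n), (∏ n, U n (j n) (k n)) * Ψ k

/-- The mode-`n` Gram matrix of a tensor: its `(a,b)` entry is
`Σ Ψ(j[n↦a])·conj(Ψ(j[n↦b]))`, summed over the indices in the other modes. -/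
noncomputable def gram {N : ℕ} {d : Fin N → ℕ} (Ψ : Tensor d) (n : Fin N) :
    Matrix (Fin (d n)) (Fin (d n)) ℂ :=
  fun a b => ∑ j : ∀ m, Fin (d m),
    if j n = a then Ψ j * (starRingEnd ℂ) (Ψ (Function.update j n b)) else 0

/-- A tensor is in HOSVD (core) form if each mode-`n` Gram matrix is diagonal
with real, nonnegative, non-increasing diagonal entries. -/
def IsHOSVD {N : ℕ} {d : Fin N → ℕ} (Ω : Tensor d) : Prop :=
  ∀ n : Fin N,
    (gram Ω n).IsDiag ∧
    (∀ a, (gram Ω n a a).im = 0 ∧ 0 ≤ (gram Ω n a a).re) ∧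
    (∀ a b : Fin (d n), a ≤ b → (gram Ω n b b).re ≤ (gram Ω n a a).re)

/-- LU equivalence of tensors. -/
def LUEquiv {N : ℕ} {d : Fin N → ℕ} (Ψ Ψ' : Tensor d) : Prop :=
  ∃ U : ∀ n, Matrix (Fin (d n)) (Fin (d n)) ℂ,
    (∀ n, U n ∈ Matrix.unitaryGroup (Fin (d n)) ℂ) ∧ Ψ' = luAct U Ψ

section LocalAction

variable {N : ℕ} {d : Fin N → ℕ}

theorem luAct_luAct (U V : ∀ n, Matrix (Fin (d n)) (Fin (d n)) ℂ) (Ψ : Tensor d) :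
    luAct U (luAct V Ψ) = luAct (fun n => U n * V n) Ψ := by
  funext j
  simp only [luAct, Matrix.mul_apply, Finset.prod_univ_sum, Fintype.piFinset_univ,
    Finset.mul_sum, Finset.sum_mul, Finset.prod_mul_distrib]
  rw [Finset.sum_comm]
  simp only [mul_assoc]

theorem luAct_diagonal (v : ∀ n, Fin (d n) → ℂ) (Ψ : Tensor d) (j : ∀ n, Fin (d n)) :
    luAct (fun n => diagonal (v n)) Ψ j = (∏ n, v n (j n)) * Ψ j := by
  unfold luAct
  rw [Finset.sum_eq_single j]
  · simp
  · intro k _ hk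
    obtain ⟨n, hn⟩ := Function.ne_iff.mp hk
    have h0 : ∏ m, diagonal (v m) (j m) (k m) = 0 :=
      Finset.prod_eq_zero (Finset.mem_univ n) (diagonal_apply_ne _ hn.symm)
    exact mul_eq_zero_of_left h0 _
  · simp

theorem sum_luAct_mul_conj (U : ∀ n, Matrix (Fin (d n)) (Fin (d n)) ℂ) (Ψ Φ : Tensor d) :
    ∑ j, luAct U Ψ j * (starRingEnd ℂ) (Φ j) =
      ∑ j, Ψ j * (starRingEnd ℂ) (luAct (fun n => (U n)ᴴ) Φ j) := by
  simp only [luAct, Finset.sum_mul, Finset.mul_sum, map_sum, map_mul, map_prod,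
    conjTranspose_apply, starRingEnd_apply, star_star]
  rw [Finset.sum_comm]
  exact Finset.sum_congr rfl fun _ _ => Finset.sum_congr rfl fun _ _ => by ring

theorem luAct_update_one (n : Fin N) (M : Matrix (Fin (d n)) (Fin (d n)) ℂ) (Ψ : Tensor d)
    (j : ∀ n, Fin (d n)) :
    luAct (Function.update (fun _ => 1) n M) Ψ j =
      ∑ c, M (j n) c * Ψ (Function.update j n c) := by
  unfold luAct
  have hinj : Function.Injective (Function.update j n) := Function.update_injective j n
  have himage : ∑ c, M (j n) c * Ψ (Function.update j n c) =
      ∑ k ∈ Finset.univ.image (Function.update j n), M (j n) (k n) * Ψ k := by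
    rw [Finset.sum_image hinj.injOn]
    simp
  rw [himage]
  symm
  refine (Finset.sum_congr rfl ?_).trans (Finset.sum_subset (Finset.subset_univ _) ?_)
  · intro k hk
    obtain ⟨c, -, rfl⟩ := Finset.mem_image.mp hk
    rw [Finset.prod_eq_single n]
    · simp
    · intro m _ hm
      simp [hm]
    · simp
  · intro k _ hk
    have : ∃ m, m ≠ n ∧ j m ≠ k m := by
      by_contra! h
      refine hk (Finset.mem_image.mpr ⟨k n, Finset.mem_univ _, ?_⟩)
      exact Function.update_eq_iff.mpr ⟨rfl, fun m hm => h m hm⟩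
    obtain ⟨m, hm, hjk⟩ := this
    rw [Finset.prod_eq_zero (Finset.mem_univ m), zero_mul]
    rw [Function.update_of_ne hm, one_apply_ne hjk]

theorem sum_mul_conj_luAct_update_one (n : Fin N) (M : Matrix (Fin (d n)) (Fin (d n)) ℂ)
    (Ψ : Tensor d) :
    ∑ j, Ψ j * (starRingEnd ℂ) (luAct (Function.update (fun _ => 1) n M) Ψ j) =
      ∑ p, ∑ q, (starRingEnd ℂ) (M p q) * gram Ψ n p q := by
  simp only [luAct_update_one, _root_.gram, Finset.mul_sum, map_sum, map_mul]
  rw [Finset.sum_comm]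
  conv_rhs => rw [Finset.sum_comm]
  refine Finset.sum_congr rfl fun q _ => ?_
  rw [Finset.sum_comm]
  refine Finset.sum_congr rfl fun j _ => ?_
  simp only [mul_ite, mul_zero, Finset.sum_ite_eq, Finset.mem_univ, if_true]
  ring

theorem gram_eq_sum_mul_conj_luAct (Ψ : Tensor d) (n : Fin N) (a b : Fin (d n)) :
    gram Ψ n a b = ∑ j, Ψ j *
      (starRingEnd ℂ) (luAct (Function.update (fun _ => 1) n (single a b 1)) Ψ j) := by
  rw [sum_mul_conj_luAct_update_one, Finset.sum_eq_single a, Finset.sum_eq_single b] <;>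
    simp +contextual [single_apply, eq_comm]

theorem gram_luAct {U : ∀ n, Matrix (Fin (d n)) (Fin (d n)) ℂ}
    (hU : ∀ n, U n ∈ unitaryGroup (Fin (d n)) ℂ) (Ψ : Tensor d) (n : Fin N) :
    gram (luAct U Ψ) n = U n * gram Ψ n * (U n)ᴴ := by
  ext a b
  rw [gram_eq_sum_mul_conj_luAct, sum_luAct_mul_conj, luAct_luAct, luAct_luAct]
  have hE : (fun m => (U m)ᴴ * Function.update (fun m => (1 : Matrix (Fin (d m)) (Fin (d m)) ℂ)) n
      (single a b 1) m * U m) =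
      Function.update (fun m => (1 : Matrix (Fin (d m)) (Fin (d m)) ℂ)) n
        ((U n)ᴴ * single a b 1 * U n) := by
    funext m
    rcases eq_or_ne m n with rfl | hm
    · simp
    · rw [Function.update_of_ne hm, Function.update_of_ne hm, mul_one]
      exact mem_unitaryGroup_iff'.mp (hU m)
  rw [hE, sum_mul_conj_luAct_update_one]
  simp only [Matrix.mul_apply (M := U n * _root_.gram Ψ n), Matrix.mul_apply (M := U n),
    Finset.sum_mul]
  rw [Finset.sum_comm]
  refine Finset.sum_congr rfl fun q _ => Finset.sum_congr rfl fun p _ => ?_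
  have hM : ((U n)ᴴ * single a b 1 * U n : Matrix (Fin (d n)) (Fin (d n)) ℂ) p q =
        star (U n a p) * U n b q := by
    rw [Matrix.mul_apply, Finset.sum_eq_single b]
    · simp
    · intro c _ hc
      rw [mul_single_apply_of_ne _ _ _ _ _ hc, zero_mul]
    · simp
  rw [hM]
  simp only [map_mul, starRingEnd_apply, star_star, conjTranspose_apply]
  ring

end LocalAction

/-- A unitary that intertwines an antitone diagonal matrix with a strictly antitone one is
diagonal. -/
theorem isDiag_of_diagonal_mul_eq_mul_diagonal {k : ℕ} {U : Matrix (Fin k) (Fin k) ℂ}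
    (hU : U ∈ unitaryGroup (Fin k) ℂ) {x y : Fin k → ℝ} (hx : StrictAnti x) (hy : Antitone y)
    (h : ∀ a b, (y a : ℂ) * U a b = U a b * x b) : U.IsDiag := by
  have hval : ∀ a b, U a b ≠ 0 → y a = x b := fun a b hab => by
    have := h a b
    rw [mul_comm] at this
    exact_mod_cast mul_left_cancel₀ hab this
  have hrow : ∀ a b, ∑ c, U a c * star (U b c) = (1 : Matrix (Fin k) (Fin k) ℂ) a b :=
    fun a b => by
      rw [← mem_unitaryGroup_iff.mp hU, Matrix.mul_apply]
      rfl
  have hne : ∀ a, ∃ b, U a b ≠ 0 := by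
    intro a
    by_contra! h0
    have := hrow a a
    simp [h0] at this
  choose σ hσ using hne
  have huniq : ∀ a b, U a b ≠ 0 → b = σ a := fun a b hab =>
    hx.injective ((hval a b hab).symm.trans (hval a _ (hσ a)))
  have hinj : Function.Injective σ := by
    intro a b hab
    by_contra hne
    have := hrow a b
    rw [one_apply_ne hne, Finset.sum_eq_single (σ a)] at this
    · have hb := hσ b
      rw [← hab] at hb
      exact mul_ne_zero (hσ a) (star_ne_zero.mpr hb) this
    · intro c _ hc
      rw [not_not.mp fun h0 => hc (huniq a c h0), zero_mul]
    · simp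
  have hmono : Monotone σ := by
    intro a b hab
    have := hy hab
    rw [hval a _ (hσ a), hval b _ (hσ b)] at this
    exact hx.le_iff_ge.mp this
  have hid : σ = id := (hmono.strictMono_of_injective hinj).eq_id
  intro a b hab
  by_contra h0
  have := huniq a b h0
  rw [hid] at this
  exact hab this.symm

/-- LU-equivalence criterion in the nondegenerate case: two HOSVD core tensors
whose mode singular values are all distinct are LU equivalent iff they differ
by local phases. -/
theorem hosvd_LU_iff_phases {N : ℕ} {d : Fin N → ℕ} (Ω Ω' : Tensor d)
    (hΩ : IsHOSVD Ω) (hΩ' : IsHOSVD Ω')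
    (hdist : ∀ n, ∀ a b : Fin (d n), a ≠ b → gram Ω n a a ≠ gram Ω n b b) :
    LUEquiv Ω Ω' ↔
      ∃ θ : ∀ n, Fin (d n) → ℝ,
        ∀ j, Ω' j = Complex.exp (Complex.I * (∑ n, θ n (j n) : ℝ)) * Ω j := by
  constructor
  · rintro ⟨U, hU, rfl⟩
    have hdiag : ∀ n, (U n).IsDiag := by
      intro n
      have hreal : ∀ {Ψ : Tensor d}, IsHOSVD Ψ →
          gram Ψ n = diagonal fun a => ((gram Ψ n a a).re : ℂ) := by
        intro Ψ hΨ
        rw [← (hΨ n).1.diagonal_diag]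
        congr 1
        funext a
        apply Complex.ext <;> simp [(hΨ n).2.1 a]
      have hx : StrictAnti fun a => (gram Ω n a a).re := by
        refine Antitone.strictAnti_of_injective (fun a b => (hΩ n).2.2 a b) fun a b hab => ?_
        by_contra hne
        exact hdist n a b hne
          (Complex.ext hab (by rw [((hΩ n).2.1 a).1, ((hΩ n).2.1 b).1]))
      refine isDiag_of_diagonal_mul_eq_mul_diagonal (hU n) hx
        (fun a b => (hΩ' n).2.2 a b) fun a b => ?_
      have hcomm : gram (luAct U Ω) n * U n = U n * gram Ω n := by
        rw [gram_luAct hU, mul_assoc]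
        have : (U n)ᴴ * U n = 1 := mem_unitaryGroup_iff'.mp (hU n)
        rw [this, mul_one]
      have hab := congrFun (congrFun hcomm a) b
      rwa [hreal hΩ, hreal hΩ', diagonal_mul, mul_diagonal] at hab
    have hUd : U = fun n => diagonal (U n).diag := funext fun n => (hdiag n).diagonal_diag.symm
    have hnorm : ∀ n a, ‖U n a a‖ = 1 := by
      intro n a
      have h1 := congrFun (congrFun (mem_unitaryGroup_iff.mp (hU n)) a) a
      rw [Matrix.mul_apply, Finset.sum_eq_single a, one_apply_eq, star_apply] at h1
      · have h2 := congrArg norm h1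
        rw [norm_mul, norm_star, norm_one] at h2
        nlinarith [norm_nonneg (U n a a)]
      · intro c _ hc
        rw [hdiag n hc.symm, zero_mul]
      · simp
    refine ⟨fun n a => (U n a a).arg, fun j => ?_⟩
    conv_lhs => rw [hUd]
    rw [luAct_diagonal, Complex.ofReal_sum, Finset.mul_sum, Complex.exp_sum]
    congr 1
    refine Finset.prod_congr rfl fun n _ => ?_
    have := Complex.norm_mul_exp_arg_mul_I (U n (j n) (j n))
    rw [hnorm, Complex.ofReal_one, one_mul, mul_comm] at this
    exact this.symm
  · rintro ⟨θ, hθ⟩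
    refine ⟨fun n => diagonal fun a => Complex.exp (Complex.I * θ n a), fun n => ?_, ?_⟩
    · rw [mem_unitaryGroup_iff, star_eq_conjTranspose, diagonal_conjTranspose,
        diagonal_mul_diagonal, ← diagonal_one]
      congr 1
      funext a
      simp [← Complex.exp_conj, ← Complex.exp_add]
    · funext j
      rw [luAct_diagonal, hθ j, Complex.ofReal_sum, Finset.mul_sum, Complex.exp_sum]
end

section
/- (Theorem 2, precise form) Let ρ = Tr_0(|Ψ_0⟩⟨Ψ_0|) and ρ' = Tr_0(|Ψ'_0⟩⟨Ψ'_0|) be N-partite mixed states obtained from unit-vector purifications Ψ_0, Ψ'_0 : Fin r × J → ℂ with J = Π_{n=1}^{N} Fin(d n). Let Ω_0 and Ω'_0 be HOSVD cores of Ψ_0 and Ψ'_0 respectively, regarded as (N+1)-partite tensors with the ancilla as the 0th mode (i.e. Ω_0 = (W^(0) ⊗ ⋯ ⊗ W^(N))·Ψ_0 is in HOSVD form, and similarly Ω'_0). Then there exist local unitaries U^(1), …, U^(N) with ρ' = (U^(1) ⊗ ⋯ ⊗ U^(N)) ρ (U^(1) ⊗ ⋯ ⊗ U^(N))† if and only if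 there exist unitary matrices S^(0), S^(1), …, S^(N) with S^(n)·G_n(Ω_0) = G_n(Ω_0)·S^(n) for every n ∈ {0,1,…,N}, such that Ω'_0 = (S^(0) ⊗ S^(1) ⊗ ⋯ ⊗ S^(N))·Ω_0. -/
open Matrix

/-- Outer product |v⟩⟨v| of a vector. -/
noncomputable def outerProd {α : Type*} (v : α → ℂ) : Matrix α α ℂ :=
  fun x y => v x * (starRingEnd ℂ) (v y)

/-- Partial trace over the ancilla (the `Fin r` factor). -/
noncomputable def ptrace0 {r : ℕ} {J : Type*}
    (M : Matrix (Fin r × J) (Fin r × J) ℂ) : Matrix J J ℂ :=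
  fun j j' => ∑ i : Fin r, M (i, j) (i, j')

/-- Kronecker product `U^(1) ⊗ ⋯ ⊗ U^(N)` of local matrices. -/
noncomputable def kron {N : ℕ} {d : Fin N → ℕ}
    (U : ∀ n, Matrix (Fin (d n)) (Fin (d n)) ℂ) :
    Matrix (∀ n, Fin (d n)) (∀ n, Fin (d n)) ℂ :=
  fun j k => ∏ n, U n (j n) (k n)

/-- Action of an ancilla unitary together with local unitaries on an
`(N+1)`-partite tensor `Ψ : Fin r × (Π n, Fin (d n)) → ℂ` (ancilla = 0th mode). -/
noncomputable def luAct0 {r N : ℕ} {d : Fin N → ℕ}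
    (W : Matrix (Fin r) (Fin r) ℂ)
    (U : ∀ n, Matrix (Fin (d n)) (Fin (d n)) ℂ)
    (Ψ : Fin r × (∀ n, Fin (d n)) → ℂ) : Fin r × (∀ n, Fin (d n)) → ℂ :=
  fun x => ∑ i' : Fin r, ∑ j' : ∀ n, Fin (d n), W x.1 i' * kron U x.2 j' * Ψ (i', j')

/-- Mode-0 (ancilla) Gram matrix. -/
noncomputable def gram0 {r N : ℕ} {d : Fin N → ℕ}
    (Ψ : Fin r × (∀ n, Fin (d n)) → ℂ) : Matrix (Fin r) (Fin r) ℂ :=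
  fun a b => ∑ j : ∀ n, Fin (d n), Ψ (a, j) * (starRingEnd ℂ) (Ψ (b, j))

/-- Mode-`n` Gram matrix (for the system modes `n = 1,…,N`). -/
noncomputable def gramn {r N : ℕ} {d : Fin N → ℕ}
    (Ψ : Fin r × (∀ n, Fin (d n)) → ℂ) (n : Fin N) :
    Matrix (Fin (d n)) (Fin (d n)) ℂ :=
  fun a b => ∑ i : Fin r, ∑ j : ∀ m, Fin (d m),
    if j n = a then Ψ (i, j) * (starRingEnd ℂ) (Ψ (i, Function.update j n b)) else 0

/-- HOSVD form for an `(N+1)`-partite tensor with the ancilla as the 0th mode: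
every mode Gram matrix is diagonal with real, nonnegative, non-increasing
diagonal entries. -/
def IsHOSVD0 {r N : ℕ} {d : Fin N → ℕ} (Ω : Fin r × (∀ n, Fin (d n)) → ℂ) : Prop :=
  ((gram0 Ω).IsDiag ∧ (∀ a, (gram0 Ω a a).im = 0 ∧ 0 ≤ (gram0 Ω a a).re) ∧
    (∀ a b : Fin r, a ≤ b → (gram0 Ω b b).re ≤ (gram0 Ω a a).re)) ∧
  ∀ n : Fin N,
    (gramn Ω n).IsDiag ∧ (∀ a, (gramn Ω n a a).im = 0 ∧ 0 ≤ (gramn Ω n a a).re) ∧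
    (∀ a b : Fin (d n), a ≤ b → (gramn Ω n b b).re ≤ (gramn Ω n a a).re)

section LinearAlgebra

/-- If `f` and `g` have pointwise equal norms, then `g` factors through `f` by an isometry. -/
lemma exists_linearIsometry_comp_eq {E F : Type*} [AddCommGroup E] [Module ℂ E]
    [NormedAddCommGroup F] [InnerProductSpace ℂ F] [FiniteDimensional ℂ F]
    (f g : E →ₗ[ℂ] F) (h : ∀ x, ‖g x‖ = ‖f x‖) :
    ∃ L : F →ₗᵢ[ℂ] F, L.toLinearMap ∘ₗ f = g := by
  have hker : LinearMap.ker f ≤ LinearMap.ker g := fun x hx => by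
    rw [LinearMap.mem_ker] at hx ⊢
    rw [← norm_eq_zero, h, hx, norm_zero]
  let φ : LinearMap.range f →ₗ[ℂ] F :=
    (LinearMap.ker f).liftQ g hker ∘ₗ f.quotKerEquivRange.symm.toLinearMap
  have hφ : ∀ x, φ ⟨f x, x, rfl⟩ = g x := fun x => by
    have : f.quotKerEquivRange.symm ⟨f x, x, rfl⟩ = (LinearMap.ker f).mkQ x :=
      f.quotKerEquivRange_symm_apply_image x _
    simp [φ, this]
  let L : LinearMap.range f →ₗᵢ[ℂ] F :=
    ⟨φ, by rintro ⟨_, x, rfl⟩; rw [hφ, h]; rfl⟩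
  refine ⟨L.extend, LinearMap.ext fun x => ?_⟩
  exact (L.extend_apply ⟨f x, x, rfl⟩).trans (hφ x)

lemma norm_sq_toEuclideanLin_conjTranspose {ι κ : Type*} [Fintype ι] [DecidableEq ι] [Fintype κ]
    [DecidableEq κ] (A : Matrix ι κ ℂ) (x : EuclideanSpace ℂ ι) :
    ((‖Matrix.toEuclideanLin Aᴴ x‖ ^ 2 : ℝ) : ℂ)
      = inner ℂ (Matrix.toEuclideanLin (A * Aᴴ) x) x := by
  have hcomp : Matrix.toEuclideanLin (A * Aᴴ) x
      = Matrix.toEuclideanLin A (Matrix.toEuclideanLin Aᴴ x) := by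
    simp [Matrix.toLpLin_apply]
  rw [hcomp, ← LinearMap.adjoint_inner_right, ← Matrix.toEuclideanLin_conjTranspose_eq_adjoint,
    inner_self_eq_norm_sq_to_K]
  simp

/-- Unitary freedom: matrices with equal `A * Aᴴ` differ by a unitary on the right. -/
lemma exists_unitary_mul_eq {ι κ : Type*} [Fintype ι] [DecidableEq ι] [Fintype κ]
    [DecidableEq κ] (A B : Matrix ι κ ℂ) (h : B * Bᴴ = A * Aᴴ) :
    ∃ V ∈ Matrix.unitaryGroup κ ℂ, B = A * V := by
  obtain ⟨L, hL⟩ := exists_linearIsometry_comp_eq (Matrix.toEuclideanLin Aᴴ)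
    (Matrix.toEuclideanLin Bᴴ) fun x => by
      have := norm_sq_toEuclideanLin_conjTranspose B x
      rw [h, ← norm_sq_toEuclideanLin_conjTranspose A x, Complex.ofReal_inj] at this
      exact (sq_eq_sq₀ (norm_nonneg _) (norm_nonneg _)).1 this
  obtain ⟨V, hV⟩ := Matrix.toEuclideanLin.surjective L.toLinearMap
  have hB : V * Aᴴ = Bᴴ := by
    apply Matrix.toEuclideanLin.injective
    rw [← hL, ← hV]
    ext x : 1
    simp [Matrix.toLpLin_apply]
  have hVV : Vᴴ * V = 1 := by
    apply Matrix.toEuclideanLin.injective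
    have := L.adjoint_comp_self'
    rw [← hV, ← Matrix.toEuclideanLin_conjTranspose_eq_adjoint] at this
    ext x : 1
    have hx := LinearMap.congr_fun this x
    simpa [Matrix.toLpLin_apply] using hx
  refine ⟨Vᴴ, ?_, ?_⟩
  · rw [Matrix.mem_unitaryGroup_iff, Matrix.star_eq_conjTranspose,
      Matrix.conjTranspose_conjTranspose, hVV]
  · rw [← Matrix.conjTranspose_conjTranspose B, ← hB]
    simp

lemma transpose_mem_unitaryGroup {κ : Type*} [Fintype κ] [DecidableEq κ] {V : Matrix κ κ ℂ}
    (hV : V ∈ Matrix.unitaryGroup κ ℂ) : Vᵀ ∈ Matrix.unitaryGroup κ ℂ := by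
  rw [Matrix.mem_unitaryGroup_iff']
  have h := congrArg Matrix.transpose (Matrix.mem_unitaryGroup_iff.1 hV)
  rwa [Matrix.transpose_mul, Matrix.transpose_one] at h

/-- Antitone families with the same multiset of values coincide. -/
lemma eq_of_antitone_of_map_univ_eq {k : ℕ} {f g : Fin k → ℝ} (hf : Antitone f) (hg : Antitone g)
    (h : (Finset.univ : Finset (Fin k)).val.map f = Finset.univ.val.map g) : f = g := by
  have hfg : List.ofFn f = List.ofFn g := by
    refine List.Perm.eq_of_sortedGE hf.sortedGE_ofFn hg.sortedGE_ofFn ?_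
    rw [← Multiset.coe_eq_coe]
    simpa [List.ofFn_eq_map] using h
  exact List.ofFn_injective hfg

/-- Unitarily conjugate diagonal matrices with real non-increasing diagonals coincide. -/
lemma eq_of_conj_of_isDiag_of_antitone {k : ℕ} {G G' S : Matrix (Fin k) (Fin k) ℂ}
    (hS : S ∈ Matrix.unitaryGroup (Fin k) ℂ) (hconj : G' = S * G * Sᴴ)
    (hG : G.IsDiag) (hGim : ∀ a, (G a a).im = 0)
    (hGa : ∀ a b : Fin k, a ≤ b → (G b b).re ≤ (G a a).re)
    (hG' : G'.IsDiag) (hGim' : ∀ a, (G' a a).im = 0)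
    (hGa' : ∀ a b : Fin k, a ≤ b → (G' b b).re ≤ (G' a a).re) : G' = G := by
  have hchar : G'.charpoly = G.charpoly := by
    rw [hconj, Matrix.charpoly_mul_comm, ← mul_assoc, ← Matrix.star_eq_conjTranspose,
      Matrix.mem_unitaryGroup_iff'.1 hS, one_mul]
  have hroots : ∀ M : Matrix (Fin k) (Fin k) ℂ, M.IsDiag →
      M.charpoly.roots = Finset.univ.val.map (fun a => M a a) := fun M hM => by
    conv_lhs => rw [← hM.diagonal_diag, Matrix.charpoly_diagonal]
    exact Polynomial.roots_multiset_prod_X_sub_C (Finset.univ.val.map (fun a => M a a)) ▸ by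
      simp [Finset.prod, Function.comp_def]
  have hmap := congrArg (Multiset.map Complex.re)
    ((hroots G' hG').symm.trans ((congrArg Polynomial.roots hchar).trans (hroots G hG)))
  rw [Multiset.map_map, Multiset.map_map] at hmap
  have hre := eq_of_antitone_of_map_univ_eq (fun a b => hGa' a b) (fun a b => hGa a b) hmap
  rw [← hG.diagonal_diag, ← hG'.diagonal_diag]
  congr 1
  ext a
  exact Complex.ext (congrFun hre a) ((hGim' a).trans (hGim a).symm)

lemma commute_of_conj_eq {k : ℕ} {G S : Matrix (Fin k) (Fin k) ℂ}
    (hS : S ∈ Matrix.unitaryGroup (Fin k) ℂ) (h : G = S * G * Sᴴ) : S * G = G * S := by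
  conv_rhs => rw [h, mul_assoc, ← Matrix.star_eq_conjTranspose,
    Matrix.mem_unitaryGroup_iff'.1 hS, mul_one]

end LinearAlgebra

section Kron

variable {N : ℕ} {d : Fin N → ℕ}

lemma kron_mul_kron (U V : ∀ n, Matrix (Fin (d n)) (Fin (d n)) ℂ) :
    kron U * kron V = kron (fun n => U n * V n) := by
  ext j k
  simp only [Matrix.mul_apply, kron, ← Finset.prod_mul_distrib]
  rw [Finset.prod_univ_sum, Fintype.piFinset_univ]

lemma kron_conjTranspose (U : ∀ n, Matrix (Fin (d n)) (Fin (d n)) ℂ) :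
    (kron U)ᴴ = kron (fun n => (U n)ᴴ) := by
  ext j k
  simp [Matrix.conjTranspose_apply, kron]

lemma kron_one : kron (fun n => (1 : Matrix (Fin (d n)) (Fin (d n)) ℂ)) = 1 := by
  ext j k
  simp only [kron, Matrix.one_apply]
  rw [Finset.prod_ite_zero]
  simp [funext_iff]

lemma kron_mem_unitaryGroup {U : ∀ n, Matrix (Fin (d n)) (Fin (d n)) ℂ}
    (hU : ∀ n, U n ∈ Matrix.unitaryGroup (Fin (d n)) ℂ) :
    kron U ∈ Matrix.unitaryGroup (∀ n, Fin (d n)) ℂ := by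
  rw [Matrix.mem_unitaryGroup_iff, Matrix.star_eq_conjTranspose, kron_conjTranspose, kron_mul_kron,
    ← kron_one]
  congr 1
  ext1 n
  exact Matrix.mem_unitaryGroup_iff.1 (hU n)

/-- The operator acting as `X` on mode `n` and trivially on the other modes. -/
noncomputable def localOp (n : Fin N) (X : Matrix (Fin (d n)) (Fin (d n)) ℂ) :
    Matrix (∀ n, Fin (d n)) (∀ n, Fin (d n)) ℂ :=
  kron (Function.update (fun m => (1 : Matrix (Fin (d m)) (Fin (d m)) ℂ)) n X)

lemma localOp_apply_update (n : Fin N) (X : Matrix (Fin (d n)) (Fin (d n)) ℂ)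
    (k : ∀ n, Fin (d n)) (b : Fin (d n)) :
    localOp n X (Function.update k n b) k = X b (k n) := by
  rw [localOp, kron, Finset.prod_eq_single n]
  · simp
  · intro m _ hm
    simp [hm]
  · simp

lemma localOp_apply_eq_zero (n : Fin N) (X : Matrix (Fin (d n)) (Fin (d n)) ℂ)
    {j k : ∀ n, Fin (d n)} (h : ∀ b, Function.update k n b ≠ j) : localOp n X j k = 0 := by
  have : ∃ m, m ≠ n ∧ j m ≠ k m := by
    by_contra! hjk
    refine h (j n) (funext fun m => ?_)
    by_cases hm : m = n
    · subst hm; simp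
    · simp [hm, hjk m hm]
  obtain ⟨m, hm, hjk⟩ := this
  rw [localOp, kron]
  exact Finset.prod_eq_zero (Finset.mem_univ m) (by simp [hm, hjk])

lemma sum_localOp_mul (n : Fin N) (X : Matrix (Fin (d n)) (Fin (d n)) ℂ)
    (k : ∀ n, Fin (d n)) (f : (∀ n, Fin (d n)) → ℂ) :
    ∑ j, localOp n X j k * f j = ∑ b, X b (k n) * f (Function.update k n b) := by
  symm
  refine Finset.sum_of_injOn (Function.update k n) (Function.update_injective k n).injOn
    (by simp) (fun j _ hj => ?_) (fun b _ => by rw [localOp_apply_update])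
  rw [localOp_apply_eq_zero n X fun b hb => hj ⟨b, by simp, hb⟩, zero_mul]

lemma conj_localOp {U : ∀ n, Matrix (Fin (d n)) (Fin (d n)) ℂ}
    (hU : ∀ n, U n ∈ Matrix.unitaryGroup (Fin (d n)) ℂ) (n : Fin N)
    (X : Matrix (Fin (d n)) (Fin (d n)) ℂ) :
    (kron U)ᴴ * localOp n X * kron U = localOp n ((U n)ᴴ * X * U n) := by
  rw [localOp, localOp, kron_conjTranspose, kron_mul_kron, kron_mul_kron]
  congr 1
  ext1 m
  by_cases hm : m = n
  · subst hm; simp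
  · simp only [Function.update_of_ne hm, mul_one]
    exact Matrix.mem_unitaryGroup_iff'.1 (hU m)

end Kron

section Tensor

variable {r N : ℕ} {d : Fin N → ℕ}

/-- The tensor reshaped as a matrix from the ancilla to the system modes. -/
def ancillaFlattening (Ψ : Fin r × (∀ n, Fin (d n)) → ℂ) : Matrix (∀ n, Fin (d n)) (Fin r) ℂ :=
  fun j i => Ψ (i, j)

lemma ancillaFlattening_injective :
    Function.Injective (ancillaFlattening (r := r) (d := d)) := fun Ψ Φ h => by
  ext ⟨i, j⟩
  exact congrFun (congrFun h j) i

lemma ancillaFlattening_luAct0 (W : Matrix (Fin r) (Fin r) ℂ)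
    (U : ∀ n, Matrix (Fin (d n)) (Fin (d n)) ℂ) (Ψ : Fin r × (∀ n, Fin (d n)) → ℂ) :
    ancillaFlattening (luAct0 W U Ψ) = kron U * ancillaFlattening Ψ * Wᵀ := by
  ext j i
  simp only [ancillaFlattening, luAct0, Matrix.mul_apply, Matrix.transpose_apply, Finset.sum_mul]
  exact Finset.sum_congr rfl fun _ _ => Finset.sum_congr rfl fun _ _ => by ring

lemma ptrace0_outerProd (Ψ : Fin r × (∀ n, Fin (d n)) → ℂ) :
    ptrace0 (outerProd Ψ) = ancillaFlattening Ψ * (ancillaFlattening Ψ)ᴴ := by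
  ext j k
  simp [ptrace0, outerProd, ancillaFlattening, Matrix.mul_apply]

lemma luAct0_luAct0 (W V : Matrix (Fin r) (Fin r) ℂ)
    (U T : ∀ n, Matrix (Fin (d n)) (Fin (d n)) ℂ) (Ψ : Fin r × (∀ n, Fin (d n)) → ℂ) :
    luAct0 W U (luAct0 V T Ψ) = luAct0 (W * V) (fun n => U n * T n) Ψ := by
  apply ancillaFlattening_injective
  simp only [ancillaFlattening_luAct0, ← kron_mul_kron, Matrix.transpose_mul, Matrix.mul_assoc]

lemma luAct0_star_luAct0 {W : Matrix (Fin r) (Fin r) ℂ}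
    {U : ∀ n, Matrix (Fin (d n)) (Fin (d n)) ℂ} (hW : W ∈ Matrix.unitaryGroup (Fin r) ℂ)
    (hU : ∀ n, U n ∈ Matrix.unitaryGroup (Fin (d n)) ℂ) (Ψ : Fin r × (∀ n, Fin (d n)) → ℂ) :
    luAct0 (star W) (fun n => star (U n)) (luAct0 W U Ψ) = Ψ := by
  apply ancillaFlattening_injective
  simp only [luAct0_luAct0, ancillaFlattening_luAct0, Matrix.mem_unitaryGroup_iff'.1 hW,
    fun n => Matrix.mem_unitaryGroup_iff'.1 (hU n), kron_one, Matrix.transpose_one,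
    Matrix.one_mul, Matrix.mul_one]

lemma ptrace0_outerProd_luAct0 {W : Matrix (Fin r) (Fin r) ℂ}
    (hW : W ∈ Matrix.unitaryGroup (Fin r) ℂ) (U : ∀ n, Matrix (Fin (d n)) (Fin (d n)) ℂ)
    (Ψ : Fin r × (∀ n, Fin (d n)) → ℂ) :
    ptrace0 (outerProd (luAct0 W U Ψ)) = kron U * ptrace0 (outerProd Ψ) * (kron U)ᴴ := by
  have hWt : Wᵀ * Wᵀᴴ = 1 :=
    Matrix.mem_unitaryGroup_iff.1 (transpose_mem_unitaryGroup hW)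
  simp only [ptrace0_outerProd, ancillaFlattening_luAct0, Matrix.conjTranspose_mul]
  calc _ = kron U * ancillaFlattening Ψ * (Wᵀ * Wᵀᴴ) * (ancillaFlattening Ψ)ᴴ * (kron U)ᴴ := by
        simp only [Matrix.mul_assoc]
    _ = _ := by rw [hWt, Matrix.mul_one]; simp only [Matrix.mul_assoc]

/-- Purifications of locally unitarily equivalent states are locally unitarily equivalent. -/
lemma exists_luAct0_eq_of_ptrace0_eq {U : ∀ n, Matrix (Fin (d n)) (Fin (d n)) ℂ}
    {Ψ Ψ' : Fin r × (∀ n, Fin (d n)) → ℂ}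
    (h : ptrace0 (outerProd Ψ') = kron U * ptrace0 (outerProd Ψ) * (kron U)ᴴ) :
    ∃ V ∈ Matrix.unitaryGroup (Fin r) ℂ, Ψ' = luAct0 V U Ψ := by
  obtain ⟨V, hV, hVeq⟩ := exists_unitary_mul_eq (kron U * ancillaFlattening Ψ)
    (ancillaFlattening Ψ') (by
      rw [← ptrace0_outerProd, h, ptrace0_outerProd, Matrix.conjTranspose_mul]
      simp only [Matrix.mul_assoc])
  refine ⟨Vᵀ, transpose_mem_unitaryGroup hV, ancillaFlattening_injective ?_⟩
  rw [ancillaFlattening_luAct0, Matrix.transpose_transpose, hVeq]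

lemma gram0_eq (Ψ : Fin r × (∀ n, Fin (d n)) → ℂ) :
    gram0 Ψ = (ancillaFlattening Ψ)ᵀ * (ancillaFlattening Ψ)ᵀᴴ := by
  ext a b
  simp [gram0, ancillaFlattening, Matrix.mul_apply]

lemma gram0_luAct0 (W : Matrix (Fin r) (Fin r) ℂ)
    {U : ∀ n, Matrix (Fin (d n)) (Fin (d n)) ℂ}
    (hU : ∀ n, U n ∈ Matrix.unitaryGroup (Fin (d n)) ℂ) (Ψ : Fin r × (∀ n, Fin (d n)) → ℂ) :
    gram0 (luAct0 W U Ψ) = W * gram0 Ψ * Wᴴ := by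
  have hK : (kron U)ᵀ * (kron U)ᵀᴴ = 1 :=
    Matrix.mem_unitaryGroup_iff.1 (transpose_mem_unitaryGroup (kron_mem_unitaryGroup hU))
  simp only [gram0_eq, ancillaFlattening_luAct0, Matrix.transpose_mul, Matrix.conjTranspose_mul,
    Matrix.transpose_transpose]
  calc _ = W * (ancillaFlattening Ψ)ᵀ * ((kron U)ᵀ * (kron U)ᵀᴴ) *
        (ancillaFlattening Ψ)ᵀᴴ * Wᴴ := by
        simp only [Matrix.mul_assoc]
    _ = _ := by rw [hK, Matrix.mul_one]; simp only [Matrix.mul_assoc]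

/-- The mode-`n` Gram matrix is the reduced state of mode `n`. -/
lemma trace_localOp_mul_ptrace0 (Ψ : Fin r × (∀ n, Fin (d n)) → ℂ) (n : Fin N)
    (X : Matrix (Fin (d n)) (Fin (d n)) ℂ) :
    (localOp n X * ptrace0 (outerProd Ψ)).trace = (X * gramn Ψ n).trace := by
  have hL : (localOp n X * ptrace0 (outerProd Ψ)).trace
      = ∑ k, ∑ b, X b (k n) *
        ∑ i, Ψ (i, k) * (starRingEnd ℂ) (Ψ (i, Function.update k n b)) := by
    simp only [Matrix.trace, Matrix.diag_apply, Matrix.mul_apply]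
    rw [Finset.sum_comm]
    exact Finset.sum_congr rfl fun k _ =>
      sum_localOp_mul n X k fun j => ptrace0 (outerProd Ψ) k j
  rw [hL]
  simp only [Matrix.trace, Matrix.diag_apply, Matrix.mul_apply, gramn]
  rw [Finset.sum_comm]
  refine Finset.sum_congr rfl fun b _ => ?_
  simp only [Finset.mul_sum]
  rw [Finset.sum_comm, Finset.sum_comm (s := (Finset.univ : Finset (Fin (d n))))]
  refine Finset.sum_congr rfl fun i _ => ?_
  rw [Finset.sum_comm]
  refine Finset.sum_congr rfl fun k _ => ?_
  simp

lemma gramn_luAct0 {W : Matrix (Fin r) (Fin r) ℂ}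
    {U : ∀ n, Matrix (Fin (d n)) (Fin (d n)) ℂ} (hW : W ∈ Matrix.unitaryGroup (Fin r) ℂ)
    (hU : ∀ n, U n ∈ Matrix.unitaryGroup (Fin (d n)) ℂ) (Ψ : Fin r × (∀ n, Fin (d n)) → ℂ)
    (n : Fin N) : gramn (luAct0 W U Ψ) n = U n * gramn Ψ n * (U n)ᴴ := by
  refine Matrix.ext_iff_trace_mul_left.2 fun X => ?_
  calc (X * gramn (luAct0 W U Ψ) n).trace
      = (localOp n X * (kron U * ptrace0 (outerProd Ψ)) * (kron U)ᴴ).trace := by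
        rw [← trace_localOp_mul_ptrace0, ptrace0_outerProd_luAct0 hW]
        simp only [Matrix.mul_assoc]
    _ = ((kron U)ᴴ * localOp n X * kron U * ptrace0 (outerProd Ψ)).trace := by
        rw [Matrix.trace_mul_comm]
        simp only [Matrix.mul_assoc]
    _ = ((U n)ᴴ * (X * (U n * gramn Ψ n))).trace := by
        rw [conj_localOp hU, trace_localOp_mul_ptrace0]
        simp only [Matrix.mul_assoc]
    _ = _ := by
        rw [Matrix.trace_mul_comm]
        simp only [Matrix.mul_assoc]

/-- Unitaries relating two tensors in HOSVD form commute with the mode Gram matrices. -/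
lemma IsHOSVD0.commute_gram {Ω : Fin r × (∀ n, Fin (d n)) → ℂ} {S0 : Matrix (Fin r) (Fin r) ℂ}
    {S : ∀ n, Matrix (Fin (d n)) (Fin (d n)) ℂ} (hΩ : IsHOSVD0 Ω)
    (hΩ' : IsHOSVD0 (luAct0 S0 S Ω)) (hS0 : S0 ∈ Matrix.unitaryGroup (Fin r) ℂ)
    (hS : ∀ n, S n ∈ Matrix.unitaryGroup (Fin (d n)) ℂ) :
    S0 * gram0 Ω = gram0 Ω * S0 ∧ ∀ n, S n * gramn Ω n = gramn Ω n * S n := by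
  obtain ⟨⟨h0, h0r, h0a⟩, h⟩ := hΩ
  obtain ⟨⟨h0', h0r', h0a'⟩, h'⟩ := hΩ'
  constructor
  · have hconj := gram0_luAct0 S0 hS Ω
    refine commute_of_conj_eq hS0 (Eq.trans (Eq.symm ?_) hconj)
    exact eq_of_conj_of_isDiag_of_antitone hS0 hconj h0 (fun a => (h0r a).1) h0a
      h0' (fun a => (h0r' a).1) h0a'
  · intro n
    have hconj := gramn_luAct0 hS0 hS Ω n
    obtain ⟨hd, hr, ha⟩ := h n
    obtain ⟨hd', hr', ha'⟩ := h' n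
    refine commute_of_conj_eq (hS n) (Eq.trans (Eq.symm ?_) hconj)
    exact eq_of_conj_of_isDiag_of_antitone (hS n) hconj hd (fun a => (hr a).1) ha
      hd' (fun a => (hr' a).1) ha'

end Tensor

/-- Theorem 2 (precise form): the mixed states `ρ` and `ρ'` are LU equivalent
iff the HOSVD cores of their purifications are related by a block-diagonal
local unitary symmetry (one factor per mode, each commuting with the
corresponding mode Gram matrix of `Ω_0`). -/
theorem mixed_LU_iff_core_symmetry {r N : ℕ} {d : Fin N → ℕ}
    (Ψ0 Ψ0' : Fin r × (∀ n, Fin (d n)) → ℂ)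
    (hΨ0 : ∑ x, Ψ0 x * (starRingEnd ℂ) (Ψ0 x) = 1)
    (hΨ0' : ∑ x, Ψ0' x * (starRingEnd ℂ) (Ψ0' x) = 1)
    (ρ ρ' : Matrix (∀ n, Fin (d n)) (∀ n, Fin (d n)) ℂ)
    (hρ : ρ = ptrace0 (outerProd Ψ0))
    (hρ' : ρ' = ptrace0 (outerProd Ψ0'))
    (W0 : Matrix (Fin r) (Fin r) ℂ)
    (W : ∀ n, Matrix (Fin (d n)) (Fin (d n)) ℂ)
    (hW0 : W0 ∈ Matrix.unitaryGroup (Fin r) ℂ)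
    (hW : ∀ n, W n ∈ Matrix.unitaryGroup (Fin (d n)) ℂ)
    (W0' : Matrix (Fin r) (Fin r) ℂ)
    (W' : ∀ n, Matrix (Fin (d n)) (Fin (d n)) ℂ)
    (hW0' : W0' ∈ Matrix.unitaryGroup (Fin r) ℂ)
    (hW' : ∀ n, W' n ∈ Matrix.unitaryGroup (Fin (d n)) ℂ)
    (Ω0 Ω0' : Fin r × (∀ n, Fin (d n)) → ℂ)
    (hΩ0 : Ω0 = luAct0 W0 W Ψ0) (hΩ0core : IsHOSVD0 Ω0)
    (hΩ0' : Ω0' = luAct0 W0' W' Ψ0') (hΩ0'core : IsHOSVD0 Ω0') :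
    (∃ U : ∀ n, Matrix (Fin (d n)) (Fin (d n)) ℂ,
        (∀ n, U n ∈ Matrix.unitaryGroup (Fin (d n)) ℂ) ∧
        ρ' = kron U * ρ * (kron U)ᴴ) ↔
    (∃ (S0 : Matrix (Fin r) (Fin r) ℂ) (S : ∀ n, Matrix (Fin (d n)) (Fin (d n)) ℂ),
        (S0 ∈ Matrix.unitaryGroup (Fin r) ℂ ∧ S0 * gram0 Ω0 = gram0 Ω0 * S0) ∧
        (∀ n, S n ∈ Matrix.unitaryGroup (Fin (d n)) ℂ ∧
          S n * gramn Ω0 n = gramn Ω0 n * S n) ∧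
        Ω0' = luAct0 S0 S Ω0) := by
  subst hρ hρ'
  have hinv : luAct0 (star W0) (fun n => star (W n)) Ω0 = Ψ0 := by
    rw [hΩ0, luAct0_star_luAct0 hW0 hW]
  have hinv' : luAct0 (star W0') (fun n => star (W' n)) Ω0' = Ψ0' := by
    rw [hΩ0', luAct0_star_luAct0 hW0' hW']
  constructor
  · rintro ⟨U, hU, hUρ⟩
    obtain ⟨V, hV, hΨ⟩ := exists_luAct0_eq_of_ptrace0_eq hUρ
    have hS0 : W0' * (V * star W0) ∈ Matrix.unitaryGroup (Fin r) ℂ :=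
      mul_mem hW0' (mul_mem hV (Unitary.star_mem hW0))
    have hS : ∀ n, W' n * (U n * star (W n)) ∈ Matrix.unitaryGroup (Fin (d n)) ℂ := fun n =>
      mul_mem (hW' n) (mul_mem (hU n) (Unitary.star_mem (hW n)))
    have hΩ : Ω0' = luAct0 (W0' * (V * star W0)) (fun n => W' n * (U n * star (W n))) Ω0 := by
      rw [hΩ0', hΨ, ← hinv, luAct0_luAct0, luAct0_luAct0]
      simp only [mul_assoc]
    obtain ⟨hc0, hc⟩ := hΩ0core.commute_gram (hΩ ▸ hΩ0'core) hS0 hS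
    exact ⟨_, _, ⟨hS0, hc0⟩, fun n => ⟨hS n, hc n⟩, hΩ⟩
  · rintro ⟨S0, S, ⟨hS0, -⟩, hS, hΩ⟩
    refine ⟨fun n => star (W' n) * (S n * W n),
      fun n => mul_mem (Unitary.star_mem (hW' n)) (mul_mem (hS n).1 (hW n)), ?_⟩
    have hV : star W0' * (S0 * W0) ∈ Matrix.unitaryGroup (Fin r) ℂ :=
      mul_mem (Unitary.star_mem hW0') (mul_mem hS0 hW0)
    rw [← ptrace0_outerProd_luAct0 hV, ← hinv', hΩ, hΩ0, luAct0_luAct0, luAct0_luAct0]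
    simp only [mul_assoc]
end
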